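/- Let 0 < α < n, 0 < β < 1 with α + β < n, and 1 < η < n/(α+β), and let Ω be homogeneous of degree zero, have mean value zero on S^{n−1}, and be a Lipschitz function. There exists a constant C, independent of b, f, Q and x, such that for every b ∈ Lip_β(ℝ^n), every locally η-integrable function f for which the integrals below converge absolutely, every cube Q = Q(x₀, r) with center x₀, and every x ∈ Q: | T_{Ω,α}( (b − b_{2Q}) f χ_{(2Q)^c} )(x) − T_{Ω,α}( (b − b_{2Q}) f χ_{(2Q)^c} )(x₀) | ≤ C ‖b‖_{Lip_β} ( M_{αη+βη}(|f|^η)(x) )^{1/η}, where 2Q is the cube concentric with Q of twice the side length and χ_{(2Q)^c} is the characteristic function of ℝ^n \ 2Q. -/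

import Mathlib

open MeasureTheory ENNReal Metric

noncomputable section

/-- The (closed) cube centered at `x` with side length `r`. -/
def cube {n : ℕ} (x : EuclideanSpace ℝ (Fin n)) (r : ℝ) : Set (EuclideanSpace ℝ (Fin n)) :=
  {y | ∀ i, |y i - x i| ≤ r / 2}

/-- The average `f_Q = |Q|⁻¹ ∫_Q f` of `f` over a set `Q`. -/
def setAvg {n : ℕ} (Q : Set (EuclideanSpace ℝ (Fin n))) (f : EuclideanSpace ℝ (Fin n) → ℝ) : ℝ :=
  (volume Q).toReal⁻¹ * ∫ y in Q, f y

/-- Slice norm of an `ℝ≥0∞`-valued function. -/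
def sliceNormE {n : ℕ} (p q t : ℝ) (g : EuclideanSpace ℝ (Fin n) → ℝ≥0∞) : ℝ≥0∞ :=
  (∫⁻ x, ((volume (cube x t))⁻¹ * ∫⁻ y in cube x t, g y ^ p) ^ (q / p)) ^ (1 / q)

/-- The slice space norm `‖f‖_{(E_p^q)_t}`. -/
def sliceNorm {n : ℕ} (p q t : ℝ) (f : EuclideanSpace ℝ (Fin n) → ℝ) : ℝ≥0∞ :=
  sliceNormE p q t fun y => ENNReal.ofReal |f y|

/-- Membership in the slice space `(E_p^q)_t(ℝⁿ)`. -/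
def MemSlice {n : ℕ} (p q t : ℝ) (f : EuclideanSpace ℝ (Fin n) → ℝ) : Prop :=
  Measurable f ∧ sliceNorm p q t f ≠ ∞

/-- The BMO seminorm, as a supremum over all cubes. -/
def bmoNorm {n : ℕ} (b : EuclideanSpace ℝ (Fin n) → ℝ) : ℝ≥0∞ :=
  ⨆ (x : EuclideanSpace ℝ (Fin n)) (r : ℝ) (_ : 0 < r),
    (volume (cube x r))⁻¹ * ∫⁻ y in cube x r, ENNReal.ofReal |b y - setAvg (cube x r) b|

/-- Membership in `BMO(ℝⁿ)`. -/
def MemBMO {n : ℕ} (b : EuclideanSpace ℝ (Fin n) → ℝ) : Prop :=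
  LocallyIntegrable b volume ∧ bmoNorm b ≠ ∞

/-- `Ω` is homogeneous of degree zero. -/
def HomogZero {n : ℕ} (Ω : EuclideanSpace ℝ (Fin n) → ℝ) : Prop :=
  ∀ lam : ℝ, 0 < lam → ∀ x : EuclideanSpace ℝ (Fin n), x ≠ 0 → Ω (lam • x) = Ω x

/-- `Ω` has mean value zero on the unit sphere. -/
def MeanZeroOnSphere {n : ℕ} (Ω : EuclideanSpace ℝ (Fin n) → ℝ) : Prop :=
  ∫ x : sphere (0 : EuclideanSpace ℝ (Fin n)) 1, Ω x
    ∂((volume : Measure (EuclideanSpace ℝ (Fin n))).toSphere) = 0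

/-- The fractional integral operator with rough kernel,
`T_{Ω,α} f (x) = ∫ Ω(x-y) |x-y|^{α-n} f(y) dy`. -/
def fracInt {n : ℕ} (Ω : EuclideanSpace ℝ (Fin n) → ℝ) (α : ℝ)
    (f : EuclideanSpace ℝ (Fin n) → ℝ) (x : EuclideanSpace ℝ (Fin n)) : ℝ :=
  ∫ y, Ω (x - y) * ‖x - y‖ ^ (α - n) * f y

/-- The commutator `[b, T_{Ω,α}] f = b ⬝ T_{Ω,α} f - T_{Ω,α}(b f)`. -/
def commutatorOp {n : ℕ} (Ω : EuclideanSpace ℝ (Fin n) → ℝ) (α : ℝ)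
    (b f : EuclideanSpace ℝ (Fin n) → ℝ) : EuclideanSpace ℝ (Fin n) → ℝ :=
  fun x => b x * fracInt Ω α f x - fracInt Ω α (fun y => b y * f y) x

/-- The fractional maximal operator `M_γ` (over cubes); `γ = 0` gives the
Hardy–Littlewood maximal operator. -/
def fracMax {n : ℕ} (γ : ℝ) (f : EuclideanSpace ℝ (Fin n) → ℝ)
    (x : EuclideanSpace ℝ (Fin n)) : ℝ≥0∞ :=
  ⨆ (z : EuclideanSpace ℝ (Fin n)) (r : ℝ) (_ : 0 < r) (_ : x ∈ cube z r),
    volume (cube z r) ^ (γ / n - 1) * ∫⁻ y in cube z r, ENNReal.ofReal |f y|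

/-- The Fefferman–Stein sharp maximal operator `M^♯`. -/
def sharpMax {n : ℕ} (f : EuclideanSpace ℝ (Fin n) → ℝ)
    (x : EuclideanSpace ℝ (Fin n)) : ℝ≥0∞ :=
  ⨆ (z : EuclideanSpace ℝ (Fin n)) (r : ℝ) (_ : 0 < r) (_ : x ∈ cube z r),
    (volume (cube z r))⁻¹ * ∫⁻ y in cube z r, ENNReal.ofReal |f y - setAvg (cube z r) f|

/-- The `L^p` norm. -/
def lpNorm {n : ℕ} (p : ℝ) (f : EuclideanSpace ℝ (Fin n) → ℝ) : ℝ≥0∞ :=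
  (∫⁻ x, ENNReal.ofReal |f x| ^ p) ^ (1 / p)

/-- The set of admissible Hölder–Lipschitz constants of order `β` for `b`. -/
def LipConstSet {n : ℕ} (β : ℝ) (b : EuclideanSpace ℝ (Fin n) → ℝ) : Set ℝ :=
  {C : ℝ | ∀ x y, |b x - b y| ≤ C * dist x y ^ β}

/-- Membership in the Lipschitz space `Lip_β(ℝⁿ)`. -/
def MemLip {n : ℕ} (β : ℝ) (b : EuclideanSpace ℝ (Fin n) → ℝ) : Prop :=
  (LipConstSet β b).Nonempty

/-- The `Lip_β` norm: the least admissible constant. -/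
def lipNorm {n : ℕ} (β : ℝ) (b : EuclideanSpace ℝ (Fin n) → ℝ) : ℝ :=
  sInf (LipConstSet β b)

section Geometry

variable {n : ℕ}

lemma norm_le_of_forall_abs_le {v : EuclideanSpace ℝ (Fin n)} {c : ℝ} (hc : 0 ≤ c)
    (h : ∀ i, |v i| ≤ c) : ‖v‖ ≤ n * c := by
  rw [EuclideanSpace.norm_eq]
  apply Real.sqrt_le_iff.2 ⟨by positivity, ?_⟩
  have h1 : ∑ i, ‖v i‖ ^ 2 ≤ ∑ _i : Fin n, c ^ 2 :=
    Finset.sum_le_sum fun i _ => by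
      rw [Real.norm_eq_abs]
      exact pow_le_pow_left₀ (abs_nonneg _) (h i) 2
  have h2 : (n : ℝ) ≤ (n : ℝ) ^ 2 := by exact_mod_cast Nat.le_self_pow two_ne_zero n
  calc _ ≤ _ := h1
    _ = n * c ^ 2 := by simp
    _ ≤ (n : ℝ) ^ 2 * c ^ 2 := by gcongr
    _ = _ := by ring

lemma abs_apply_le_norm (v : EuclideanSpace ℝ (Fin n)) (i : Fin n) : |v i| ≤ ‖v‖ :=
  PiLp.norm_apply_le v i

lemma cube_eq_preimage (x : EuclideanSpace ℝ (Fin n)) {r : ℝ} (hr : 0 ≤ r) :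
    cube x r = WithLp.ofLp ⁻¹' closedBall (WithLp.ofLp x) (r / 2) := by
  ext y
  simp only [cube, Set.mem_ofPred_eq, Set.mem_preimage, mem_closedBall]
  rw [dist_pi_le_iff (by positivity)]
  rfl

lemma isClosed_cube (x : EuclideanSpace ℝ (Fin n)) (r : ℝ) : IsClosed (cube x r) := by
  simp only [cube, Set.ofPred_forall]
  exact isClosed_iInter fun i => isClosed_le (by fun_prop) continuous_const

lemma measurableSet_cube (x : EuclideanSpace ℝ (Fin n)) (r : ℝ) : MeasurableSet (cube x r) :=
  (isClosed_cube x r).measurableSet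

lemma norm_sub_le_of_mem_cube {x y : EuclideanSpace ℝ (Fin n)} {r : ℝ} (hr : 0 ≤ r)
    (hy : y ∈ cube x r) : ‖y - x‖ ≤ n * (r / 2) :=
  norm_le_of_forall_abs_le (by positivity) hy

lemma exists_lt_abs_of_notMem_cube {x y : EuclideanSpace ℝ (Fin n)} {r : ℝ}
    (hy : y ∉ cube x r) : ∃ i, r / 2 < |y i - x i| := by
  simpa [cube] using hy

lemma lt_norm_sub_of_notMem_cube {x y : EuclideanSpace ℝ (Fin n)} {r : ℝ}
    (hy : y ∉ cube x r) : r / 2 < ‖y - x‖ := by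
  obtain ⟨i, hi⟩ := exists_lt_abs_of_notMem_cube hy
  exact hi.trans_le (abs_apply_le_norm (y - x) i)

lemma isCompact_cube (x : EuclideanSpace ℝ (Fin n)) {r : ℝ} (hr : 0 ≤ r) :
    IsCompact (cube x r) :=
  (isCompact_closedBall x (n * (r / 2))).of_isClosed_subset (isClosed_cube x r) fun y hy => by
    rw [mem_closedBall, dist_eq_norm]
    exact norm_sub_le_of_mem_cube hr hy

lemma volume_cube (x : EuclideanSpace ℝ (Fin n)) {r : ℝ} (hr : 0 ≤ r) :
    volume (cube x r) = ENNReal.ofReal r ^ (n : ℝ) := by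
  rw [cube_eq_preimage x hr, (PiLp.volume_preserving_ofLp (Fin n)).measure_preimage
    measurableSet_closedBall.nullMeasurableSet, Real.volume_pi_closedBall _ (by positivity),
    ENNReal.rpow_natCast, Fintype.card_fin, mul_div_cancel₀ _ two_ne_zero,
    ENNReal.ofReal_pow hr]

/-- Points of a cube see the exterior of the doubled cube at distances comparable to those from
the center. -/
lemma norm_center_sub_le {x₀ x y : EuclideanSpace ℝ (Fin n)} {r : ℝ} (hr : 0 < r)
    (hx : x ∈ cube x₀ r) (hy : y ∉ cube x₀ (2 * r)) : ‖x₀ - y‖ ≤ (n + 1) * ‖x - y‖ := by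
  obtain ⟨i, hi⟩ := exists_lt_abs_of_notMem_cube hy
  have h1 : |x i - y i| ≤ ‖x - y‖ := abs_apply_le_norm (x - y) i
  have h2 : |x i - x₀ i| ≤ r / 2 := hx i
  have h3 : |y i - x₀ i| ≤ |x i - y i| + |x i - x₀ i| := by
    rw [abs_sub_comm (x i) (y i)]
    exact abs_sub_le _ _ _
  have h4 := norm_sub_le_of_mem_cube hr.le hx
  have h5 : ‖x₀ - y‖ ≤ ‖x - x₀‖ + ‖x - y‖ := by
    rw [norm_sub_rev x x₀]
    exact norm_sub_le_norm_sub_add_norm_sub _ _ _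
  have h6 : (n : ℝ) * (r / 2) ≤ n * ‖x - y‖ := by gcongr; linarith
  linarith

end Geometry

section Kernel

lemma abs_rpow_neg_sub_rpow_neg_le {s m a b : ℝ} (hs : 0 < s) (hm : 0 < m) (ha : m ≤ a)
    (hb : m ≤ b) : |a ^ (-s) - b ^ (-s)| ≤ s * m ^ (-s - 1) * |a - b| := by
  have key := (convex_Ici m).norm_image_sub_le_of_norm_hasDerivWithin_le
    (f := fun t : ℝ => t ^ (-s)) (f' := fun t => -s * t ^ (-s - 1)) (C := s * m ^ (-s - 1))
    (fun t ht => (Real.hasDerivAt_rpow_const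
      (Or.inl (hm.trans_le ht).ne')).hasDerivWithinAt) (fun t ht => ?_) hb ha
  · simpa using key
  · have ht0 : 0 < t := hm.trans_le ht
    rw [norm_mul, norm_neg, Real.norm_of_nonneg hs.le,
      Real.norm_of_nonneg (Real.rpow_nonneg ht0.le _)]
    gcongr ?_ * ?_
    exact Real.rpow_le_rpow_of_nonpos hm ht (by linarith)

variable {E : Type*} [NormedAddCommGroup E] [NormedSpace ℝ E]

lemma norm_inv_norm_smul_sub_le {u v : E} (hu : u ≠ 0) (hv : v ≠ 0) :
    ‖‖u‖⁻¹ • u - ‖v‖⁻¹ • v‖ ≤ 2 * ‖u - v‖ / ‖u‖ := by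
  have hu' := norm_pos_iff.2 hu
  have hv' := norm_pos_iff.2 hv
  have h : ‖u‖⁻¹ • u - ‖v‖⁻¹ • v = ‖u‖⁻¹ • (u - v) + (‖u‖⁻¹ - ‖v‖⁻¹) • v := by
    simp only [smul_sub, sub_smul]; abel
  have h2 : ‖u‖⁻¹ - ‖v‖⁻¹ = (‖v‖ - ‖u‖) / (‖u‖ * ‖v‖) := by field_simp
  have h3 : |‖v‖ - ‖u‖| ≤ ‖u - v‖ := by
    rw [norm_sub_rev]; exact abs_norm_sub_norm_le v u
  calc _ ≤ ‖u‖⁻¹ * ‖u - v‖ + |‖v‖ - ‖u‖| / (‖u‖ * ‖v‖) * ‖v‖ := by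
        rw [h]
        refine (norm_add_le _ _).trans_eq ?_
        rw [norm_smul, norm_smul, h2, norm_inv, norm_norm, norm_div, norm_mul, norm_norm,
          norm_norm, Real.norm_eq_abs]
    _ ≤ ‖u‖⁻¹ * ‖u - v‖ + ‖u - v‖ / (‖u‖ * ‖v‖) * ‖v‖ := by gcongr
    _ = _ := by field_simp; ring

/-- Regularity of a homogeneous kernel whose angular part is bounded and Lipschitz. -/
lemma abs_kernel_sub_le {Ω : E → ℝ} {L : NNReal} {s A M : ℝ} (hs : 0 < s) (hA : 0 < A)
    (hhom : ∀ lam : ℝ, 0 < lam → ∀ x : E, x ≠ 0 → Ω (lam • x) = Ω x)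
    (hlip : LipschitzOnWith L Ω (sphere (0 : E) 1)) (hM : ∀ x : E, x ≠ 0 → |Ω x| ≤ M)
    {u v : E} (hu : u ≠ 0) (hA1 : 1 ≤ A) (huv : ‖u‖ ≤ A * ‖v‖) :
    |Ω v * ‖v‖ ^ (-s) - Ω u * ‖u‖ ^ (-s)| ≤
      (M * s * A ^ (s + 1) + 2 * L) * (‖u - v‖ * ‖u‖ ^ (-s - 1)) := by
  have hu' := norm_pos_iff.2 hu
  have hv' : 0 < ‖v‖ := pos_of_mul_pos_right (hu'.trans_le huv) hA.le
  have hv : v ≠ 0 := norm_pos_iff.1 hv'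
  have hM0 : 0 ≤ M := (abs_nonneg _).trans (hM u hu)
  have hr := abs_rpow_neg_sub_rpow_neg_le hs (div_pos hu' hA)
    (div_le_of_le_mul₀ hA.le hv'.le (by linarith)) (div_le_self hu'.le hA1)
  have hmA : (‖u‖ / A) ^ (-s - 1) = A ^ (s + 1) * ‖u‖ ^ (-s - 1) := by
    rw [Real.div_rpow hu'.le hA.le, show -s - 1 = -(s + 1) by ring, Real.rpow_neg hA.le]
    field_simp
  have h3 : |‖v‖ - ‖u‖| ≤ ‖u - v‖ := by
    rw [norm_sub_rev]; exact abs_norm_sub_norm_le v u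
  have hΩ : |Ω v - Ω u| ≤ 2 * L * ‖u - v‖ / ‖u‖ := by
    rw [← hhom ‖u‖⁻¹ (by positivity) u hu, ← hhom ‖v‖⁻¹ (by positivity) v hv, abs_sub_comm]
    have h4 := hlip.dist_le_mul (‖u‖⁻¹ • u) (by simp [norm_smul, hu'.ne'])
      (‖v‖⁻¹ • v) (by simp [norm_smul, hv'.ne'])
    rw [Real.dist_eq, dist_eq_norm] at h4
    refine h4.trans ((mul_le_mul_of_nonneg_left (norm_inv_norm_smul_sub_le hu hv)
      L.coe_nonneg).trans_eq ?_)
    ring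
  have hpow : ‖u‖ ^ (-s - 1) = ‖u‖ ^ (-s) / ‖u‖ := Real.rpow_sub_one hu'.ne' _
  calc _ = |Ω v * (‖v‖ ^ (-s) - ‖u‖ ^ (-s)) + (Ω v - Ω u) * ‖u‖ ^ (-s)| := by congr 1; ring
    _ ≤ |Ω v| * |‖v‖ ^ (-s) - ‖u‖ ^ (-s)| + |Ω v - Ω u| * ‖u‖ ^ (-s) := by
        refine (abs_add_le _ _).trans_eq ?_
        rw [abs_mul, abs_mul, abs_of_nonneg (Real.rpow_nonneg hu'.le (-s))]
    _ ≤ M * (s * (A ^ (s + 1) * ‖u‖ ^ (-s - 1)) * ‖u - v‖)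
        + 2 * L * ‖u - v‖ / ‖u‖ * ‖u‖ ^ (-s) := by
        rw [hmA] at hr
        gcongr
        · exact hM v hv
        · exact hr.trans (by gcongr)
    _ = _ := by rw [hpow]; ring

/-- A degree-zero homogeneous function that is Lipschitz on the sphere is bounded. -/
lemma exists_abs_le_of_homogeneous {Ω : E → ℝ} {L : NNReal}
    (hhom : ∀ lam : ℝ, 0 < lam → ∀ x : E, x ≠ 0 → Ω (lam • x) = Ω x)
    (hlip : LipschitzOnWith L Ω (sphere (0 : E) 1)) :
    ∃ M : ℝ, 0 ≤ M ∧ ∀ x : E, x ≠ 0 → |Ω x| ≤ M := by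
  by_cases h : ∃ e : E, e ≠ 0
  · obtain ⟨e, he⟩ := h
    refine ⟨|Ω e| + L * 2, by positivity, fun x hx => ?_⟩
    have he' := norm_pos_iff.2 he
    have hx' := norm_pos_iff.2 hx
    have h4 := hlip.dist_le_mul (‖x‖⁻¹ • x) (by simp [norm_smul, hx'.ne'])
      (‖e‖⁻¹ • e) (by simp [norm_smul, he'.ne'])
    rw [hhom _ (by positivity) x hx, hhom _ (by positivity) e he, Real.dist_eq,
      dist_eq_norm] at h4
    have h5 : ‖‖x‖⁻¹ • x - ‖e‖⁻¹ • e‖ ≤ 2 := by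
      refine (norm_sub_le _ _).trans_eq ?_
      simp only [norm_smul, norm_inv, norm_norm, inv_mul_cancel₀ hx'.ne',
        inv_mul_cancel₀ he'.ne']
      norm_num
    have h6 : (L : ℝ) * ‖‖x‖⁻¹ • x - ‖e‖⁻¹ • e‖ ≤ L * 2 := by gcongr
    have h7 := abs_sub_abs_le_abs_sub (Ω x) (Ω e)
    linarith
  · exact ⟨0, le_rfl, fun x hx => (h ⟨x, hx⟩).elim⟩

end Kernel

section Lipschitz

variable {n : ℕ}

lemma lipNorm_nonneg (hn : 1 ≤ n) (β : ℝ) (b : EuclideanSpace ℝ (Fin n) → ℝ) :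
    0 ≤ lipNorm β b := by
  have : Nonempty (Fin n) := ⟨⟨0, hn⟩⟩
  obtain ⟨x, y, hxy⟩ := exists_pair_ne (EuclideanSpace ℝ (Fin n))
  refine Real.sInf_nonneg fun D hD => ?_
  exact nonneg_of_mul_nonneg_left ((abs_nonneg _).trans (hD x y))
    (Real.rpow_pos_of_pos (dist_pos.2 hxy) β)

lemma abs_sub_le_lipNorm (hn : 1 ≤ n) {β : ℝ} {b : EuclideanSpace ℝ (Fin n) → ℝ}
    (hb : MemLip β b) (x y : EuclideanSpace ℝ (Fin n)) :
    |b x - b y| ≤ lipNorm β b * dist x y ^ β := by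
  rcases eq_or_ne x y with rfl | hxy
  · rw [sub_self, abs_zero]
    exact mul_nonneg (lipNorm_nonneg hn β b) (Real.rpow_nonneg dist_nonneg β)
  · have hd : 0 < dist x y ^ β := Real.rpow_pos_of_pos (dist_pos.2 hxy) β
    rw [← div_le_iff₀ hd]
    exact le_csInf hb fun C hC => (div_le_iff₀ hd).2 (hC x y)

lemma continuous_of_memLip (hn : 1 ≤ n) {β : ℝ} (hβ : 0 < β)
    {b : EuclideanSpace ℝ (Fin n) → ℝ} (hb : MemLip β b) : Continuous b := by
  have h : HolderWith (lipNorm β b).toNNReal β.toNNReal b := by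
    intro x y
    rw [edist_dist, edist_dist, Real.coe_toNNReal _ hβ.le,
      ENNReal.ofReal_rpow_of_nonneg dist_nonneg hβ.le, ← ENNReal.ofReal,
      ← ENNReal.ofReal_mul (lipNorm_nonneg hn β b)]
    exact ENNReal.ofReal_le_ofReal (abs_sub_le_lipNorm hn hb x y)
  exact h.continuous (Real.toNNReal_pos.2 hβ)

lemma abs_sub_setAvg_le {Q : Set (EuclideanSpace ℝ (Fin n))} {b : EuclideanSpace ℝ (Fin n) → ℝ}
    {c D : ℝ} (hQ0 : volume Q ≠ 0) (hQ : volume Q ≠ ∞) (hb : IntegrableOn b Q)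
    (h : ∀ z ∈ Q, |c - b z| ≤ D) : |c - setAvg Q b| ≤ D := by
  have hpos : 0 < (volume Q).toReal := ENNReal.toReal_pos hQ0 hQ
  have h1 := norm_setIntegral_le_of_norm_le_const (f := fun z => c - b z) hQ.lt_top h
  rw [integral_sub (integrableOn_const (C := c) hQ).integrable hb, setIntegral_const, smul_eq_mul,
    Real.norm_eq_abs, Measure.real] at h1
  have h2 : c - setAvg Q b
      = (volume Q).toReal⁻¹ * ((volume Q).toReal * c - ∫ z in Q, b z) := by
    rw [setAvg]; field_simp
  rw [h2, abs_mul, abs_of_pos (inv_pos.2 hpos), inv_mul_le_iff₀ hpos, mul_comm _ D]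
  exact h1

lemma abs_sub_setAvg_cube_le (hn : 1 ≤ n) {β : ℝ} (hβ : 0 < β)
    {b : EuclideanSpace ℝ (Fin n) → ℝ} (hb : MemLip β b) {x y : EuclideanSpace ℝ (Fin n)}
    {r : ℝ} (hr : 0 < r) (hy : y ∉ cube x r) :
    |b y - setAvg (cube x r) b| ≤ lipNorm β b * ((n + 1) ^ β * ‖x - y‖ ^ β) := by
  have hv : volume (cube x r) = ENNReal.ofReal r ^ (n : ℝ) := volume_cube x hr.le
  have hc := isCompact_cube x hr.le
  refine abs_sub_setAvg_le ?_ hc.measure_ne_top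
    ((continuous_of_memLip hn hβ hb).continuousOn.integrableOn_compact hc) fun z hz => ?_
  · rw [hv]
    exact (ENNReal.rpow_pos (ENNReal.ofReal_pos.2 hr) ENNReal.ofReal_ne_top).ne'
  · refine (abs_sub_le_lipNorm hn hb y z).trans ?_
    rw [← Real.mul_rpow (by positivity) (norm_nonneg _)]
    refine mul_le_mul_of_nonneg_left ?_ (lipNorm_nonneg hn β b)
    refine Real.rpow_le_rpow dist_nonneg ?_ hβ.le
    have h1 := norm_sub_le_of_mem_cube hr.le hz
    have h2 := lt_norm_sub_of_notMem_cube hy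
    have h3 : (n : ℝ) * (r / 2) ≤ n * ‖y - x‖ := by gcongr
    have h4 : ‖y - z‖ ≤ ‖y - x‖ + ‖z - x‖ := by
      rw [norm_sub_rev z x]
      exact norm_sub_le_norm_sub_add_norm_sub _ _ _
    rw [dist_eq_norm, norm_sub_rev x y]
    linarith

end Lipschitz

section Tail

variable {n : ℕ}

/-- Hölder's inequality on a cube, in terms of the fractional maximal function. -/
lemma setLIntegral_cube_le_fracMax (hn : 1 ≤ n) {δ η : ℝ} (hη : 1 < η)
    {f : EuclideanSpace ℝ (Fin n) → ℝ} (hf : Measurable f) {x z : EuclideanSpace ℝ (Fin n)}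
    {r : ℝ} (hr : 0 < r) (hx : x ∈ cube z r) :
    ∫⁻ y in cube z r, ENNReal.ofReal |f y| ≤
      fracMax (δ * η) (fun y => |f y| ^ η) x ^ (1 / η) * ENNReal.ofReal (r ^ (n - δ)) := by
  have hη0 : 0 < η := by linarith
  have hn0 : (n : ℝ) ≠ 0 := by positivity
  set V := volume (cube z r)
  set I := ∫⁻ y in cube z r, ENNReal.ofReal (|f y| ^ η)
  set M := fracMax (δ * η) (fun y => |f y| ^ η) x
  have hV : V = ENNReal.ofReal r ^ (n : ℝ) := volume_cube z hr.le
  have hV0 : V ≠ 0 := by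
    rw [hV]; exact (ENNReal.rpow_pos (ENNReal.ofReal_pos.2 hr) ENNReal.ofReal_ne_top).ne'
  have hVt : V ≠ ∞ := (isCompact_cube z hr.le).measure_ne_top
  have hM : V ^ (δ * η / n - 1) * I ≤ M := by
    have h : V ^ (δ * η / n - 1) * ∫⁻ y in cube z r, ENNReal.ofReal |(|f y| ^ η)| ≤ M :=
      le_iSup_of_le z <| le_iSup_of_le r <| le_iSup_of_le hr <| le_iSup_of_le hx le_rfl
    simpa only [abs_of_nonneg (Real.rpow_nonneg (abs_nonneg _) η)] using h
  have hI_le : I ≤ M * V ^ (1 - δ * η / n) := by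
    calc I = V ^ (δ * η / n - 1) * I * V ^ (1 - δ * η / n) := by
          rw [mul_right_comm, ← ENNReal.rpow_add _ _ hV0 hVt]; simp
      _ ≤ _ := by gcongr
  have hpq : η.HolderConjugate (Real.conjExponent η) := Real.HolderConjugate.conjExponent hη
  have hH := ENNReal.lintegral_mul_le_Lp_mul_Lq (volume.restrict (cube z r)) hpq
    (f := fun y => ENNReal.ofReal |f y|) (g := fun _ => 1)
    hf.norm.ennreal_ofReal.aemeasurable aemeasurable_const
  simp only [Pi.mul_apply, mul_one, ENNReal.one_rpow, lintegral_const, Measure.restrict_apply_univ,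
    one_mul, ENNReal.ofReal_rpow_of_nonneg (abs_nonneg _) hη0.le] at hH
  have hq : 1 / Real.conjExponent η = 1 - 1 / η := by
    have := hpq.inv_add_inv_eq_one
    simp only [one_div]; linarith
  calc _ ≤ I ^ (1 / η) * V ^ (1 / Real.conjExponent η) := hH
    _ ≤ (M * V ^ (1 - δ * η / n)) ^ (1 / η) * V ^ (1 - 1 / η) := by rw [hq]; gcongr
    _ = M ^ (1 / η) * V ^ ((1 - δ * η / n) * (1 / η) + (1 - 1 / η)) := by
        rw [ENNReal.mul_rpow_of_nonneg _ _ (by positivity), ← ENNReal.rpow_mul, mul_assoc,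
          ← ENNReal.rpow_add _ _ hV0 hVt]
    _ = M ^ (1 / η) * ENNReal.ofReal (r ^ (n - δ)) := by
        rw [hV, ← ENNReal.rpow_mul, ENNReal.ofReal_rpow_of_pos hr]
        congr 3
        field_simp
        ring

lemma compl_cube_subset_iUnion (x : EuclideanSpace ℝ (Fin n)) {r : ℝ} (hr : 0 < r) :
    (cube x (2 * r))ᶜ ⊆ ⋃ k : ℕ, cube x (4 * (2 ^ k * r)) \ cube x (2 * (2 ^ k * r)) := by
  classical
  intro y hy
  have hex : ∃ k : ℕ, y ∈ cube x (4 * (2 ^ k * r)) := by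
    obtain ⟨k, hk⟩ := pow_unbounded_of_one_lt (‖y - x‖ / r) (one_lt_two (α := ℝ))
    rw [div_lt_iff₀ hr] at hk
    refine ⟨k, fun i => (abs_apply_le_norm (y - x) i).trans ?_⟩
    have : 0 < 2 ^ k * r := by positivity
    linarith
  refine Set.mem_iUnion.2 ⟨Nat.find hex, Nat.find_spec hex, ?_⟩
  rcases h : Nat.find hex with _ | k
  · simpa using hy
  · have := Nat.find_min hex (m := k) (by omega)
    rwa [show 2 * (2 ^ (k + 1) * r) = 4 * (2 ^ k * r) by ring]

lemma setLIntegral_compl_cube_le_fracMax (hn : 1 ≤ n) {δ η : ℝ} (hδ : δ < n) (hη : 1 < η)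
    {f : EuclideanSpace ℝ (Fin n) → ℝ} (hf : Measurable f) {x x₀ : EuclideanSpace ℝ (Fin n)}
    {r : ℝ} (hr : 0 < r) (hx : x ∈ cube x₀ r) :
    ∫⁻ y in (cube x₀ (2 * r))ᶜ, ENNReal.ofReal (‖x₀ - y‖ ^ (-(n - δ) - 1) * |f y|) ≤
      ENNReal.ofReal (2 * 4 ^ (n - δ) / r) *
        fracMax (δ * η) (fun y => |f y| ^ η) x ^ (1 / η) := by
  set M := fracMax (δ * η) (fun y => |f y| ^ η) x ^ (1 / η)
  set t := (n : ℝ) - δ with ht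
  have ht0 : 0 < t := by linarith
  have hpiece (k : ℕ) : ∫⁻ y in cube x₀ (4 * (2 ^ k * r)) \ cube x₀ (2 * (2 ^ k * r)),
      ENNReal.ofReal (‖x₀ - y‖ ^ (-t - 1) * |f y|) ≤
        ENNReal.ofReal (4 ^ t / r * (1 / 2) ^ k) * M := by
    set R := 2 ^ k * r with hR
    have hR0 : 0 < R := by positivity
    have hxR : x ∈ cube x₀ (4 * R) := fun i => (hx i).trans <| by
      have : (1 : ℝ) ≤ 2 ^ k := one_le_pow₀ one_le_two
      nlinarith
    calc _ ≤ ∫⁻ y in cube x₀ (4 * R) \ cube x₀ (2 * R),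
          ENNReal.ofReal (R ^ (-t - 1)) * ENNReal.ofReal |f y| := by
          refine setLIntegral_mono' ((measurableSet_cube _ _).diff (measurableSet_cube _ _))
            fun y hy => ?_
          rw [← ENNReal.ofReal_mul (by positivity)]
          refine ENNReal.ofReal_le_ofReal (mul_le_mul_of_nonneg_right ?_ (abs_nonneg _))
          refine Real.rpow_le_rpow_of_nonpos hR0 ?_ (by linarith)
          have := lt_norm_sub_of_notMem_cube hy.2
          rw [norm_sub_rev]
          linarith
      _ ≤ ∫⁻ y in cube x₀ (4 * R), ENNReal.ofReal (R ^ (-t - 1)) * ENNReal.ofReal |f y| :=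
          lintegral_mono_set Set.sdiff_subset
      _ = ENNReal.ofReal (R ^ (-t - 1)) * ∫⁻ y in cube x₀ (4 * R), ENNReal.ofReal |f y| :=
          lintegral_const_mul _ hf.norm.ennreal_ofReal
      _ ≤ ENNReal.ofReal (R ^ (-t - 1)) * (M * ENNReal.ofReal ((4 * R) ^ t)) := by
          gcongr
          exact setLIntegral_cube_le_fracMax hn hη hf (by positivity) hxR
      _ = _ := by
          rw [mul_comm M, ← mul_assoc, ← ENNReal.ofReal_mul (by positivity)]
          congr 2
          rw [Real.mul_rpow (by norm_num) hR0.le, Real.rpow_sub_one hR0.ne',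
            Real.rpow_neg hR0.le, hR, one_div, inv_pow]
          field_simp
  calc _ ≤ ∫⁻ y in ⋃ k : ℕ, cube x₀ (4 * (2 ^ k * r)) \ cube x₀ (2 * (2 ^ k * r)),
        ENNReal.ofReal (‖x₀ - y‖ ^ (-t - 1) * |f y|) :=
        lintegral_mono_set (compl_cube_subset_iUnion x₀ hr)
    _ ≤ ∑' k : ℕ, ENNReal.ofReal (4 ^ t / r * (1 / 2) ^ k) * M :=
        (lintegral_iUnion_le _ _).trans (ENNReal.tsum_le_tsum hpiece)
    _ = _ := by
        rw [ENNReal.tsum_mul_right, ← ENNReal.ofReal_tsum_of_nonneg (fun k => by positivity)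
          (summable_geometric_two.mul_left _), tsum_mul_left, tsum_geometric_two]
        congr 2
        ring

end Tail

theorem statement17 (n : ℕ) (hn : 1 ≤ n) (α β η : ℝ) (hα0 : 0 < α) (hαn : α < n)
    (hβ0 : 0 < β) (hβ1 : β < 1) (hαβ : α + β < n)
    (hη1 : 1 < η) (hη : η < n / (α + β))
    (Ω : EuclideanSpace ℝ (Fin n) → ℝ) (hhom : HomogZero Ω) (hmean : MeanZeroOnSphere Ω)
    (L : NNReal) (hlip : LipschitzOnWith L Ω (sphere (0 : EuclideanSpace ℝ (Fin n)) 1)) :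
    ∃ C > (0 : ℝ), ∀ b : EuclideanSpace ℝ (Fin n) → ℝ, MemLip β b →
      ∀ f : EuclideanSpace ℝ (Fin n) → ℝ, Measurable f → LocallyIntegrable (fun y => |f y| ^ η) volume →
      ∀ (x₀ : EuclideanSpace ℝ (Fin n)) (r : ℝ), 0 < r → ∀ x ∈ cube x₀ r,
      ∀ g : EuclideanSpace ℝ (Fin n) → ℝ,
        g = ((cube x₀ (2 * r))ᶜ.indicator fun y =>
              (b y - setAvg (cube x₀ (2 * r)) b) * f y) →
        Integrable (fun y => Ω (x - y) * ‖x - y‖ ^ (α - n) * g y) volume →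
        Integrable (fun y => Ω (x₀ - y) * ‖x₀ - y‖ ^ (α - n) * g y) volume →
        ENNReal.ofReal |fracInt Ω α g x - fracInt Ω α g x₀| ≤
          ENNReal.ofReal (C * lipNorm β b) *
            (fracMax (α * η + β * η) (fun y => |f y| ^ η) x) ^ (1 / η) := by
  obtain ⟨M, hM0, hM⟩ := exists_abs_le_of_homogeneous hhom hlip
  set s : ℝ := n - α with hs
  have hs0 : 0 < s := by linarith
  set D : ℝ := M * s * ((n : ℝ) + 1) ^ (s + 1) + 2 * L
  have hD0 : 0 ≤ D := by positivity
  set B : ℝ := D * n * (n + 1) ^ β with hB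
  have hB0 : 0 ≤ B := by positivity
  refine ⟨(B + 1) * (2 * 4 ^ (n - (α + β))), by positivity, ?_⟩
  intro b hb f hf _ x₀ r hr x hx g hg hi hi₀
  have hl := lipNorm_nonneg hn β b
  have hpt (y : EuclideanSpace ℝ (Fin n)) (hy : y ∉ cube x₀ (2 * r)) :
      |Ω (x - y) * ‖x - y‖ ^ (α - n) * g y - Ω (x₀ - y) * ‖x₀ - y‖ ^ (α - n) * g y| ≤
        (B + 1) * lipNorm β b * r * (‖x₀ - y‖ ^ (-(n - (α + β)) - 1) * |f y|) := by
    have hgy : g y = (b y - setAvg (cube x₀ (2 * r)) b) * f y := by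
      rw [hg, Set.indicator_of_mem (by exact hy)]
    have hu : 0 < ‖x₀ - y‖ := by
      rw [norm_sub_rev]
      exact lt_of_le_of_lt (by positivity) (lt_norm_sub_of_notMem_cube hy)
    have hk := abs_kernel_sub_le (A := (n : ℝ) + 1) hs0 (by positivity) hhom hlip hM
      (norm_pos_iff.1 hu) (by linarith [n.cast_nonneg (α := ℝ)]) (norm_center_sub_le hr hx hy)
    have hd : ‖x₀ - y - (x - y)‖ ≤ n * r := by
      rw [sub_sub_sub_cancel_right, norm_sub_rev]
      refine (norm_sub_le_of_mem_cube hr.le hx).trans ?_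
      gcongr
      linarith
    have hpow : ‖x₀ - y‖ ^ (-(n - (α + β)) - 1) = ‖x₀ - y‖ ^ (-s - 1) * ‖x₀ - y‖ ^ β := by
      rw [← Real.rpow_add hu]
      congr 1
      rw [hs]; ring
    rw [hgy, ← sub_mul, show α - n = -s by rw [hs]; ring, abs_mul, abs_mul]
    calc _ ≤ D * (n * r * ‖x₀ - y‖ ^ (-s - 1)) *
          (lipNorm β b * ((n + 1) ^ β * ‖x₀ - y‖ ^ β) * |f y|) := by
          gcongr
          · exact hk.trans (by gcongr)
          · exact abs_sub_setAvg_cube_le hn hβ0 hb (by positivity) hy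
      _ = B * lipNorm β b * r * (‖x₀ - y‖ ^ (-(n - (α + β)) - 1) * |f y|) := by
          rw [hpow, hB]; ring
      _ ≤ _ := by gcongr; linarith
  have hsupp (y : EuclideanSpace ℝ (Fin n)) (hy : y ∈ cube x₀ (2 * r)) : g y = 0 := by
    rw [hg, Set.indicator_of_notMem (by simpa using hy)]
  rw [fracInt, fracInt, ← integral_sub hi hi₀, ← Real.enorm_eq_ofReal_abs, ← add_mul α β η]
  calc _ ≤ ∫⁻ y, ‖Ω (x - y) * ‖x - y‖ ^ (α - n) * g y
          - Ω (x₀ - y) * ‖x₀ - y‖ ^ (α - n) * g y‖ₑ := enorm_integral_le_lintegral_enorm _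
    _ ≤ ∫⁻ y in (cube x₀ (2 * r))ᶜ, ENNReal.ofReal ((B + 1) * lipNorm β b * r) *
          ENNReal.ofReal (‖x₀ - y‖ ^ (-(n - (α + β)) - 1) * |f y|) := by
        rw [← lintegral_indicator (measurableSet_cube _ _).compl]
        refine lintegral_mono fun y => ?_
        by_cases hy : y ∈ cube x₀ (2 * r)
        · simp [hsupp y hy]
        · rw [Set.indicator_of_mem (by exact hy), Real.enorm_eq_ofReal_abs,
            ← ENNReal.ofReal_mul (by positivity)]
          exact ENNReal.ofReal_le_ofReal (hpt y hy)
    _ = ENNReal.ofReal ((B + 1) * lipNorm β b * r) * ∫⁻ y in (cube x₀ (2 * r))ᶜ,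
          ENNReal.ofReal (‖x₀ - y‖ ^ (-(n - (α + β)) - 1) * |f y|) :=
        lintegral_const_mul' _ _ ENNReal.ofReal_ne_top
    _ ≤ ENNReal.ofReal ((B + 1) * lipNorm β b * r) *
          (ENNReal.ofReal (2 * 4 ^ (n - (α + β)) / r) *
            fracMax ((α + β) * η) (fun y => |f y| ^ η) x ^ (1 / η)) := by
        gcongr
        exact setLIntegral_compl_cube_le_fracMax hn hαβ hη1 hf hr hx
    _ = _ := by
        rw [← mul_assoc, ← ENNReal.ofReal_mul (by positivity)]
        congr 2
        field_simp

end
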